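/- arXiv:0909.4224 — 6 statements merged into one kernel-verified Lean document; each statement's English description precedes it below -/
import Mathlib

section
/- In any finite simple graph G, every minimal dominating set is a maximal irredundant set. -/
/-- A set `I` of vertices is *irredundant* in `G` if every `v ∈ I` either has no
neighbor in `I`, or has a private neighbor: a vertex `u ∉ I` adjacent to `v`
whose only neighbor in `I` is `v`. -/
def Irredundant {V : Type*} (G : SimpleGraph V) (I : Set V) : Prop :=
  ∀ v ∈ I, (∀ u ∈ I, ¬ G.Adj v u) ∨
    ∃ u, u ∉ I ∧ G.Adj u v ∧ ∀ w ∈ I, G.Adj u w → w = v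

/-- An irredundant set is *maximal* if no proper superset of it is irredundant. -/
def MaximalIrredundant {V : Type*} (G : SimpleGraph V) (I : Set V) : Prop :=
  Irredundant G I ∧ ∀ J : Set V, I ⊂ J → ¬ Irredundant G J

/-- A set `D` is *dominating* if every vertex is in `D` or adjacent to a vertex of `D`. -/
def Dominating {V : Type*} (G : SimpleGraph V) (D : Set V) : Prop :=
  ∀ v : V, v ∈ D ∨ ∃ u ∈ D, G.Adj u v

/-- A dominating set is *minimal* if no proper subset of it is dominating. -/
def MinimalDominating {V : Type*} (G : SimpleGraph V) (D : Set V) : Prop :=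
  Dominating G D ∧ ∀ D' : Set V, D' ⊂ D → ¬ Dominating G D'

theorem MinimalDominating.irredundant {V : Type*} {G : SimpleGraph V} {D : Set V}
    (hD : MinimalDominating G D) : Irredundant G D := by
  intro v hv
  have hnd := hD.2 (D \ {v}) ⟨Set.sdiff_subset, fun h => (h hv).2 rfl⟩
  simp only [Dominating, not_forall, not_or, not_exists, not_and] at hnd
  obtain ⟨t, ht, hadj⟩ := hnd
  have honly : ∀ w ∈ D, G.Adj t w → w = v := fun w hw htw => by
    by_contra hne
    exact hadj w ⟨hw, hne⟩ htw.symm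
  by_cases htv : t = v
  · subst htv
    exact Or.inl fun u hu htu => htu.ne (honly u hu htu).symm
  · have htD : t ∉ D := fun h => ht ⟨h, htv⟩
    obtain ⟨u, hu, hut⟩ := (hD.1 t).resolve_left htD
    exact Or.inr ⟨t, htD, honly u hu hut.symm ▸ hut.symm, honly⟩

/-- A proper superset of a dominating set is never irredundant. -/
theorem Dominating.not_irredundant_of_ssubset {V : Type*} {G : SimpleGraph V} {D J : Set V}
    (hD : Dominating G D) (hDJ : D ⊂ J) : ¬ Irredundant G J := by
  intro hJ
  obtain ⟨x, hxJ, hxD⟩ := Set.exists_of_ssubset hDJ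
  obtain ⟨u, hu, hux⟩ := (hD x).resolve_left hxD
  rcases hJ x hxJ with hiso | ⟨p, hpJ, -, hp⟩
  · exact hiso u (hDJ.1 hu) hux.symm
  · obtain ⟨w, hw, hwp⟩ := (hD p).resolve_left fun h => hpJ (hDJ.1 h)
    exact hxD (hp w (hDJ.1 hw) hwp.symm ▸ hw)

/-- every minimal dominating set is a maximal irredundant set. -/
theorem minimal_dominating_maximal_irredundant {V : Type*} [Fintype V]
    (G : SimpleGraph V) (D : Set V) (hD : MinimalDominating G D) :
    MaximalIrredundant G D :=
  ⟨hD.irredundant, fun _ hJ => hD.1.not_irredundant_of_ssubset hJ⟩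
end

section
/- For every finite simple graph G with at least one vertex, the domination chain ir(G) ≤ γ(G) ≤ α(G) ≤ IR(G) holds. -/
/-- `ir(G)`: the minimum cardinality of a maximal irredundant set. -/
noncomputable def irLower {V : Type*} [Fintype V] (G : SimpleGraph V) : ℕ :=
  sInf {n | ∃ I : Set V, MaximalIrredundant G I ∧ I.ncard = n}

/-- `IR(G)`: the maximum cardinality of a maximal irredundant set. -/
noncomputable def irUpper {V : Type*} [Fintype V] (G : SimpleGraph V) : ℕ :=
  sSup {n | ∃ I : Set V, MaximalIrredundant G I ∧ I.ncard = n}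

/-- `γ(G)`: the minimum cardinality of a dominating set. -/
noncomputable def domNum {V : Type*} [Fintype V] (G : SimpleGraph V) : ℕ :=
  sInf {n | ∃ D : Set V, Dominating G D ∧ D.ncard = n}

/-- `α(G)`: the maximum cardinality of an independent set. -/
noncomputable def indepNum {V : Type*} [Fintype V] (G : SimpleGraph V) : ℕ :=
  sSup {n | ∃ I : Set V, (∀ u ∈ I, ∀ w ∈ I, ¬ G.Adj u w) ∧ I.ncard = n}

theorem Irredundant.of_independent {V : Type*} {G : SimpleGraph V} {I : Set V}
    (h : ∀ u ∈ I, ∀ w ∈ I, ¬ G.Adj u w) : Irredundant G I :=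
  fun v hv => Or.inl (h v hv)

/-- An irredundant dominating set is maximal irredundant. -/
theorem Dominating.maximalIrredundant {V : Type*} {G : SimpleGraph V} {D : Set V}
    (hD : Dominating G D) (hI : Irredundant G D) : MaximalIrredundant G D := by
  refine ⟨hI, fun J hJ hJI => ?_⟩
  obtain ⟨x, hxJ, hxD⟩ := Set.exists_of_ssubset hJ
  rcases hJI x hxJ with h | ⟨u, huJ, -, hu⟩
  · rcases hD x with hx | ⟨d, hd, hadj⟩
    · exact hxD hx
    · exact h d (hJ.subset hd) hadj.symm
  · rcases hD u with hx | ⟨d, hd, hadj⟩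
    · exact huJ (hJ.subset hx)
    · exact hxD (hu d (hJ.subset hd) hadj.symm ▸ hd)

/-- A dominating set of minimum cardinality is irredundant. -/
theorem Dominating.irredundant_of_minimum {V : Type*} [Finite V] {G : SimpleGraph V} {D : Set V}
    (hD : Dominating G D) (hmin : ∀ D' : Set V, Dominating G D' → D.ncard ≤ D'.ncard) :
    Irredundant G D := by
  intro v hv
  have hnot : ¬ Dominating G (D \ {v}) := fun h =>
    (Set.ncard_sdiff_singleton_lt_of_mem hv).not_ge (hmin _ h)
  simp only [Dominating, not_forall, not_or, not_exists, not_and] at hnot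
  obtain ⟨u, huD, hu⟩ := hnot
  have huniq : ∀ w ∈ D, G.Adj u w → w = v := fun w hw hadj => by
    by_contra hne
    exact hu w ⟨hw, hne⟩ hadj.symm
  by_cases huv : u = v
  · subst huv
    exact Or.inl fun w hw hadj => hadj.ne (huniq w hw hadj).symm
  · have huD' : u ∉ D := fun h => huD ⟨h, huv⟩
    obtain ⟨d, hd, hadj⟩ := (hD u).resolve_left huD'
    exact Or.inr ⟨u, huD', huniq d hd hadj.symm ▸ hadj.symm, huniq⟩

/-- An independent set of maximum cardinality is dominating. -/
theorem dominating_of_maximum_independent {V : Type*} [Finite V] {G : SimpleGraph V} {I : Set V}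
    (hI : ∀ u ∈ I, ∀ w ∈ I, ¬ G.Adj u w)
    (hmax : ∀ J : Set V, (∀ u ∈ J, ∀ w ∈ J, ¬ G.Adj u w) → J.ncard ≤ I.ncard) :
    Dominating G I := by
  intro v
  by_contra! hv
  have hle := hmax (insert v I) (by
    rintro u (rfl | hu) w (rfl | hw)
    · exact G.irrefl
    · exact fun h => hv.2 w hw h.symm
    · exact hv.2 u hu
    · exact hI u hu w hw)
  rw [Set.ncard_insert_of_notMem hv.1] at hle
  omega

theorem bddAbove_setOf_exists_ncard {V : Type*} [Finite V] (P : Set V → Prop) :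
    BddAbove {n | ∃ I : Set V, P I ∧ I.ncard = n} := by
  refine ⟨Nat.card V, ?_⟩
  rintro n ⟨I, -, rfl⟩
  exact Set.ncard_le_card I

/-- the domination chain `ir(G) ≤ γ(G) ≤ α(G) ≤ IR(G)`. -/
theorem domination_chain {V : Type*} [Fintype V] [Nonempty V] (G : SimpleGraph V) :
    irLower G ≤ domNum G ∧ domNum G ≤ indepNum G ∧ indepNum G ≤ irUpper G := by
  obtain ⟨D, hD, hDcard⟩ : domNum G ∈ {n | ∃ D : Set V, Dominating G D ∧ D.ncard = n} :=
    Nat.sInf_mem ⟨_, Set.univ, fun v => Or.inl (Set.mem_univ v), rfl⟩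
  have hDmin : ∀ D' : Set V, Dominating G D' → D.ncard ≤ D'.ncard := fun D' h =>
    hDcard.trans_le (Nat.sInf_le ⟨D', h, rfl⟩)
  have hbdd := bddAbove_setOf_exists_ncard fun I : Set V => ∀ u ∈ I, ∀ w ∈ I, ¬ G.Adj u w
  obtain ⟨I, hI, hIcard⟩ :
      indepNum G ∈ {n | ∃ I : Set V, (∀ u ∈ I, ∀ w ∈ I, ¬ G.Adj u w) ∧ I.ncard = n} :=
    Nat.sSup_mem ⟨_, ∅, by simp, rfl⟩ hbdd
  have hIdom : Dominating G I := dominating_of_maximum_independent hI fun J hJ =>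
    (le_csSup hbdd ⟨J, hJ, rfl⟩).trans_eq hIcard.symm
  refine ⟨Nat.sInf_le ⟨D, hD.maximalIrredundant (hD.irredundant_of_minimum hDmin), hDcard⟩,
    Nat.sInf_le ⟨I, hIdom, hIcard⟩, ?_⟩
  exact le_csSup (bddAbove_setOf_exists_ncard _)
    ⟨I, hIdom.maximalIrredundant (.of_independent hI), hIcard⟩
end

section
/- For every finite simple graph G with at least one vertex, γ(G) ≤ 2·ir(G) − 1; equivalently, γ(G)/2 < ir(G). -/
theorem exists_maximalIrredundant {V : Type*} [Finite V] (G : SimpleGraph V) :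
    ∃ I : Set V, MaximalIrredundant G I := by
  obtain ⟨I, hI⟩ := (Set.toFinite {I : Set V | Irredundant G I}).exists_maximal
    ⟨∅, fun v hv => hv.elim⟩
  exact ⟨I, hI.prop, fun J hJ hJ' => hJ.not_subset (hI.le_of_ge hJ' hJ.subset)⟩

theorem MaximalIrredundant.nonempty {V : Type*} [Nonempty V] {G : SimpleGraph V} {I : Set V}
    (hI : MaximalIrredundant G I) : I.Nonempty := by
  by_contra h
  rw [Set.not_nonempty_iff_eq_empty] at h
  subst h
  obtain ⟨x⟩ := ‹Nonempty V›
  refine hI.2 {x} (Set.empty_ssubset.2 (Set.singleton_nonempty x)) fun v hv => Or.inl ?_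
  rintro u rfl hvu
  exact hvu.ne hv

/-- A maximal irredundant set, enlarged by a private neighbor of each of its non-isolated
vertices, is dominating. -/
theorem MaximalIrredundant.exists_dominating {V : Type*} [Finite V] {G : SimpleGraph V}
    {I : Set V} (hI : MaximalIrredundant G I) :
    ∃ D : Set V, I ⊆ D ∧ Dominating G D ∧ D.ncard ≤ 2 * I.ncard := by
  have h : ∀ v, ∃ u, v ∈ I → (∀ w ∈ I, ¬ G.Adj v w) ∨
      (u ∉ I ∧ G.Adj u v ∧ ∀ w ∈ I, G.Adj u w → w = v) := by
    intro v
    by_cases hv : v ∈ I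
    · rcases hI.1 v hv with h | ⟨u, hu⟩
      · exact ⟨v, fun _ => Or.inl h⟩
      · exact ⟨u, fun _ => Or.inr hu⟩
    · exact ⟨v, fun h => absurd h hv⟩
  choose p hp using h
  refine ⟨I ∪ p '' I, Set.subset_union_left, fun x => ?_, ?_⟩
  · by_contra! hx
    obtain ⟨hxD, hxadj⟩ := hx
    have hxI : x ∉ I := fun h => hxD (Or.inl h)
    refine hI.2 (insert x I) (Set.ssubset_insert hxI) fun v hv => ?_
    rcases hv with rfl | hv
    · left
      rintro u (rfl | hu) hvu
      · exact hvu.ne rfl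
      · exact hxadj u (Or.inl hu) hvu.symm
    · rcases hp v hv with hiso | ⟨hpI, hpv, hpriv⟩
      · left
        rintro u (rfl | hu) hvu
        · exact hxadj v (Or.inl hv) hvu
        · exact hiso u hu hvu
      · have hpD : p v ∈ I ∪ p '' I := Or.inr ⟨v, hv, rfl⟩
        refine Or.inr ⟨p v, ?_, hpv, ?_⟩
        · rintro (h | h)
          · exact hxD (h ▸ hpD)
          · exact hpI h
        · rintro w (rfl | hw) hadj
          · exact absurd hadj (hxadj _ hpD)
          · exact hpriv w hw hadj
  · have h₁ := Set.ncard_union_le I (p '' I)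
    have h₂ := Set.ncard_image_le (f := p) (Set.toFinite I)
    omega

theorem irredundant_of_minimal_dominating {V : Type*} {G : SimpleGraph V} {D : Set V}
    (hD : Dominating G D) (hmin : ∀ v ∈ D, ¬ Dominating G (D \ {v})) : Irredundant G D := by
  intro v hv
  have h := hmin v hv
  unfold Dominating at h
  push Not at h
  obtain ⟨x, hxD, hxadj⟩ := h
  by_cases hxv : x = v
  · subst hxv
    exact Or.inl fun u hu hadj => hxadj u ⟨hu, hadj.ne'⟩ hadj.symm
  · have hx : x ∉ D := fun h => hxD ⟨h, hxv⟩
    have hpriv : ∀ w ∈ D, G.Adj x w → w = v := fun w hw hadj => by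
      by_contra hwv
      exact hxadj w ⟨hw, hwv⟩ hadj.symm
    obtain ⟨u, hu, hux⟩ := (hD x).resolve_left hx
    exact Or.inr ⟨x, hx, hpriv u hu hux.symm ▸ hux.symm, hpriv⟩

theorem Dominating.domNum_le {V : Type*} [Fintype V] {G : SimpleGraph V} {D : Set V}
    (hD : Dominating G D) : domNum G ≤ D.ncard :=
  Nat.sInf_le ⟨D, hD, rfl⟩

theorem MaximalIrredundant.domNum_lt {V : Type*} [Fintype V] [Nonempty V] {G : SimpleGraph V}
    {I : Set V} (hI : MaximalIrredundant G I) : domNum G < 2 * I.ncard := by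
  have hpos : 0 < I.ncard := (Set.ncard_pos (Set.toFinite I)).2 hI.nonempty
  obtain ⟨D, hID, hD, hcard⟩ := hI.exists_dominating
  rcases hID.eq_or_ssubset with rfl | hss
  · have := hD.domNum_le
    omega
  · obtain ⟨v, hv, hdom⟩ : ∃ v ∈ D, Dominating G (D \ {v}) := by
      by_contra! hmin
      exact hI.2 D hss (irredundant_of_minimal_dominating hD hmin)
    have h₁ := hdom.domNum_le
    have h₂ := Set.ncard_sdiff_singleton_lt_of_mem hv (Set.toFinite D)
    omega

/-- `γ(G) ≤ 2·ir(G) − 1`; equivalently, `γ(G)/2 < ir(G)`. -/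
theorem domNum_le_two_irLower_sub_one {V : Type*} [Fintype V] [Nonempty V]
    (G : SimpleGraph V) :
    domNum G ≤ 2 * irLower G - 1 ∧ (domNum G : ℚ) / 2 < (irLower G : ℚ) := by
  obtain ⟨J, hJ⟩ := exists_maximalIrredundant G
  obtain ⟨I, hI, hcard⟩ : ∃ I : Set V, MaximalIrredundant G I ∧ I.ncard = irLower G :=
    Nat.sInf_mem (s := {n | ∃ I : Set V, MaximalIrredundant G I ∧ I.ncard = n})
      ⟨J.ncard, J, hJ, rfl⟩
  have h : domNum G < 2 * irLower G := hcard ▸ hI.domNum_lt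
  refine ⟨by omega, ?_⟩
  have h' : (domNum G : ℚ) < 2 * irLower G := by exact_mod_cast h
  linarith
end

section
/- Let G be a finite simple graph containing a crown (C, H, E'), i.e., C ⊆ V(G) is a nonempty independent set, H is the set of all vertices outside C having a neighbor in C, and there is a matching of size |H| between C and H. Then G contains a maximum-cardinality irredundant set I such that C ⊆ I and H ∩ I = ∅. -/
/-- A maximum-cardinality irredundant set exists in a finite graph. -/
theorem exists_maximum_irredundant {V : Type*} [Finite V] (G : SimpleGraph V) :
    ∃ J : Set V, Irredundant G J ∧ ∀ K : Set V, Irredundant G K → K.ncard ≤ J.ncard :=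
  Set.exists_max_image {J : Set V | Irredundant G J} Set.ncard (Set.toFinite _)
    ⟨∅, fun _ hv => hv.elim⟩

/-- Exchange step: the vertices of `J` that lie in `H`, or that lie outside `C ∪ H` and have a
private neighbor in `H`, inject into `C \ J`. -/
theorem Irredundant.ncard_le_ncard_crown_diff {V : Type*} [Finite V] {G : SimpleGraph V}
    {C H J D : Set V} (hJ : Irredundant G J)
    (hCH : ∀ c ∈ C, ∀ u, G.Adj u c → u ∈ H)
    {f : V → V} (hf : Set.InjOn f H) (hfC : ∀ u ∈ H, f u ∈ C ∧ G.Adj u (f u))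
    (hD : ∀ v ∈ D, v ∈ J ∧ (v ∈ H ∨ v ∉ C ∧ v ∉ H ∧
      ∃ u ∈ H, u ∉ J ∧ G.Adj u v ∧ ∀ w ∈ J, G.Adj u w → w = v)) :
    D.ncard ≤ (C \ J).ncard := by
  classical
  let p : V → V := fun x => if x ∈ H then f x else x
  have hp : ∀ x ∈ H, p x = f x := fun x hx => if_pos hx
  have hp' : ∀ x ∉ H, p x = x := fun x hx => if_neg hx
  have hpinj : Set.InjOn p D := by
    intro x hx y hy hxy
    by_cases hxH : x ∈ H <;> by_cases hyH : y ∈ H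
    · exact hf hxH hyH (by rwa [hp x hxH, hp y hyH] at hxy)
    · have hyC := (hD y hy).2.resolve_left hyH
      rw [hp x hxH, hp' y hyH] at hxy
      exact absurd (hxy ▸ (hfC x hxH).1) hyC.1
    · have hxC := (hD x hx).2.resolve_left hxH
      rw [hp' x hxH, hp y hyH] at hxy
      exact absurd (hxy ▸ (hfC y hyH).1) hxC.1
    · rwa [hp' x hxH, hp' y hyH] at hxy
  have key : ∀ x ∈ D, ∃ g ∈ H, f g ∉ J ∧
      (g = x ∨ g ∉ J ∧ p x ∈ J ∧ ∀ w ∈ J, G.Adj g w ↔ w = p x) := by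
    intro x hx
    obtain ⟨hxJ, hxH | ⟨hxC, hxH, u, huH, huJ, hux, hu⟩⟩ := hD x hx
    · by_cases hfx : f x ∈ J
      · obtain h | ⟨u, huJ, hux, hu⟩ := hJ _ hfx
        · exact absurd (hfC x hxH).2.symm (h x hxJ)
        · have huH : u ∈ H := hCH _ (hfC x hxH).1 u hux
          refine ⟨u, huH, fun hfu => ?_, .inr ⟨huJ, by rwa [hp x hxH], fun w hw => ?_⟩⟩
          · have hux' : u = x := hf huH hxH (hu _ hfu (hfC u huH).2)
            exact huJ (hux' ▸ hxJ)
          · rw [hp x hxH]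
            exact ⟨hu w hw, fun h => h ▸ hux⟩
      · exact ⟨x, hxH, hfx, .inl rfl⟩
    · refine ⟨u, huH, fun hfu => ?_, .inr ⟨huJ, by rwa [hp' x hxH], fun w hw => ?_⟩⟩
      · exact hxC (hu _ hfu (hfC u huH).2 ▸ (hfC u huH).1)
      · rw [hp' x hxH]
        exact ⟨hu w hw, fun h => h ▸ hux⟩
  choose! g hgH hgJ hg using key
  refine Set.ncard_le_ncard_of_injOn (fun x => f (g x))
    (fun x hx => ⟨(hfC _ (hgH x hx)).1, hgJ x hx⟩) (fun x hx y hy hxy => ?_) (Set.toFinite _)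
  have hgxy : g x = g y := hf (hgH x hx) (hgH y hy) hxy
  obtain h₁ | ⟨h₁, hx₁, hx₂⟩ := hg x hx <;> obtain h₂ | ⟨h₂, -, hy₂⟩ := hg y hy
  · rw [← h₁, hgxy, h₂]
  · exact absurd (hD x hx).1 (by rwa [← h₁, hgxy])
  · exact absurd (hD y hy).1 (by rwa [← h₂, ← hgxy])
  · exact hpinj hx hy ((hy₂ _ hx₁).1 (hgxy ▸ (hx₂ _ hx₁).2 rfl))

/-- if `G` contains a crown `(C, H, E')` — a nonempty independent set
`C`, the set `H` of all neighbors of `C` outside `C`, and a matching of size `|H|`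
between `C` and `H` (given as an injection of `H` into `C` along edges) — then `G`
has a maximum-cardinality irredundant set `I` with `C ⊆ I` and `H ∩ I = ∅`. -/
theorem crown_reduction {V : Type*} [Fintype V] (G : SimpleGraph V)
    (C H : Set V)
    (hCne : C.Nonempty)
    (hCindep : ∀ u ∈ C, ∀ w ∈ C, ¬ G.Adj u w)
    (hH : H = {u : V | u ∉ C ∧ ∃ c ∈ C, G.Adj u c})
    (hmatch : ∃ f : V → V, Set.InjOn f H ∧ ∀ u ∈ H, f u ∈ C ∧ G.Adj u (f u)) :
    ∃ I : Set V, Irredundant G I ∧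
      (∀ J : Set V, Irredundant G J → J.ncard ≤ I.ncard) ∧
      C ⊆ I ∧ H ∩ I = ∅ := by
  obtain ⟨f, hf, hfC⟩ := hmatch
  obtain ⟨J, hJ, hJmax⟩ := exists_maximum_irredundant G
  have hCH : ∀ c ∈ C, ∀ u, G.Adj u c → u ∈ H := fun c hc u huc => by
    rw [hH]
    exact ⟨fun hu => hCindep u hu c hc huc, c, hc, huc⟩
  have hdisj : ∀ u ∈ H, u ∉ C := fun u hu => by
    rw [hH] at hu
    exact hu.1
  let D : Set V := {v | v ∈ J ∧ (v ∈ H ∨ v ∉ C ∧ v ∉ H ∧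
    ∃ u ∈ H, u ∉ J ∧ G.Adj u v ∧ ∀ w ∈ J, G.Adj u w → w = v)}
  have hDcard : D.ncard ≤ (C \ J).ncard :=
    hJ.ncard_le_ncard_crown_diff hCH hf hfC fun v hv => hv
  have hIH : ∀ v ∈ C ∪ J \ D, v ∉ H := by
    rintro v (hv | ⟨hvJ, hvD⟩) hvH
    · exact hdisj v hvH hv
    · exact hvD ⟨hvJ, .inl hvH⟩
  refine ⟨C ∪ J \ D, fun v hv => ?_, fun K hK => (hJmax K hK).trans ?_,
    Set.subset_union_left, Set.eq_empty_of_forall_notMem fun v hv => hIH v hv.2 hv.1⟩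
  · by_cases hvC : v ∈ C
    · exact .inl fun u hu huv => hIH u hu (hCH v hvC u huv.symm)
    have hvH := hIH v hv
    obtain ⟨hvJ, hvD⟩ := hv.resolve_left hvC
    obtain h | ⟨u, huJ, huv, hu⟩ := hJ v hvJ
    · left
      rintro w (hw | hw) hvw
      · exact hvH (hCH w hw v hvw)
      · exact h w hw.1 hvw
    · have huH : u ∉ H := fun huH => hvD ⟨hvJ, .inr ⟨hvC, hvH, u, huH, huJ, huv, hu⟩⟩
      refine .inr ⟨u, ?_, huv, ?_⟩
      · rintro (huC | hu')
        · exact hvH (hCH u huC v huv.symm)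
        · exact huJ hu'.1
      · rintro w (hw | hw) huw
        · exact absurd (hCH w hw u huw) huH
        · exact hu w hw.1 huw
  · have hDJ : D ⊆ J := fun v hv => hv.1
    calc J.ncard = (J \ D).ncard + D.ncard := (Set.ncard_sdiff_add_ncard_of_subset hDJ).symm
      _ ≤ (J \ D).ncard + (C \ J).ncard := by gcongr
      _ = (J \ D ∪ C \ J).ncard :=
        (Set.ncard_union_eq (Set.disjoint_left.2 fun v hv hv' => hv'.2 hv.1)).symm
      _ ≤ (C ∪ J \ D).ncard := Set.ncard_le_ncard
        (Set.union_subset Set.subset_union_right (Set.sdiff_subset.trans Set.subset_union_left))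
end

section
/- Let G be a finite simple graph on n vertices and k a positive integer. If G has an irredundant set of size at least n − k, then every matching of G (in particular every maximal matching) has at most k edges. -/
/-- A *matching* of `G`: a set of edges of `G` that are pairwise vertex-disjoint. -/
def IsMatchingSet {V : Type*} (G : SimpleGraph V) (M : Set (Sym2 V)) : Prop :=
  M ⊆ G.edgeSet ∧ ∀ e ∈ M, ∀ e' ∈ M, e ≠ e' → ∀ v : V, v ∈ e → v ∉ e'

/-- A matching has at most as many edges as there are vertices outside an irredundant set. -/
theorem IsMatchingSet.ncard_le_ncard_compl {V : Type*} [Fintype V] {G : SimpleGraph V}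
    {I : Set V} (hI : Irredundant G I) {M : Set (Sym2 V)} (hM : IsMatchingSet G M) :
    M.ncard ≤ Iᶜ.ncard := by
  classical
  obtain ⟨hMG, hdisj⟩ := hM
  have huniq {u v v' : V} (h : s(u, v) ∈ M) (h' : s(u, v') ∈ M) : v = v' := by
    by_contra hne
    exact hdisj _ h _ h' (by grind) u (by simp) (by simp)
  -- The set of vertices covered by the matching.
  let C : Finset V := M.toFinset.biUnion Sym2.toFinset
  have hC : C.card = M.ncard * 2 := by
    rw [Set.ncard_eq_toFinset_card', ← smul_eq_mul, ← Finset.sum_const,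
      Finset.card_biUnion]
    · exact Finset.sum_congr rfl fun e he =>
        Sym2.card_toFinset_of_not_isDiag e
          (G.not_isDiag_of_mem_edgeSet (hMG (Set.mem_toFinset.1 he)))
    · intro e he e' he' hne
      rw [Function.onFun, Finset.disjoint_left]
      intro v hv hv'
      exact hdisj e (by simpa using he) e' (by simpa using he') hne v
        (by simpa using hv) (by simpa using hv')
  have houter : (C.filter (· ∉ I)).card ≤ Iᶜ.ncard := by
    rw [Set.ncard_eq_toFinset_card']
    exact Finset.card_le_card fun v hv => by simpa using (Finset.mem_filter.1 hv).2
  -- A covered vertex of `I` is sent to its partner if that lies outside `I`, and otherwise to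
  -- a private neighbor.
  have hex : ∀ v ∈ C.filter (· ∈ I), ∃ u, u ∉ I ∧ G.Adj u v ∧
      (s(u, v) ∈ M ∨ ∀ w ∈ I, G.Adj u w → w = v) := by
    intro v hv
    obtain ⟨hvC, hvI⟩ := Finset.mem_filter.1 hv
    obtain ⟨e, heM, hve⟩ := Finset.mem_biUnion.1 hvC
    rw [Set.mem_toFinset] at heM
    obtain ⟨w, rfl⟩ := Sym2.mem_iff_exists.1 (Sym2.mem_toFinset.1 hve)
    have hadj : G.Adj v w := hMG heM
    by_cases hw : w ∈ I
    · rcases hI v hvI with h | ⟨u, hu, huv, hpriv⟩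
      · exact absurd hadj (h w hw)
      · exact ⟨u, hu, huv, Or.inr hpriv⟩
    · exact ⟨w, hw, hadj.symm, Or.inl (Sym2.eq_swap ▸ heM)⟩
  choose! f hfI hfadj hf using hex
  have hinner : (C.filter (· ∈ I)).card ≤ Iᶜ.ncard := by
    rw [Set.ncard_eq_toFinset_card']
    refine Finset.card_le_card_of_injOn f (fun v hv => by simpa using hfI v hv) ?_
    intro v hv v' hv' heq
    have hvI := (Finset.mem_filter.1 hv).2
    have hvI' := (Finset.mem_filter.1 hv').2
    rcases hf v hv with h | h
    · rcases hf v' hv' with h' | h'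
      · exact huniq h (heq ▸ h')
      · exact h' v hvI (heq ▸ hfadj v hv)
    · exact (h v' hvI' (heq ▸ hfadj v' hv')).symm
  have hsplit := Finset.card_filter_add_card_filter_not (s := C) (· ∈ I)
  lia

/-- if `G` has an irredundant set of size at least `n − k` (with
`k ≥ 1`), then every matching of `G` has at most `k` edges. -/
theorem matching_le_of_large_irredundant {V : Type*} [Fintype V]
    (G : SimpleGraph V) (k : ℕ) (hk : 0 < k)
    (hI : ∃ I : Set V, Irredundant G I ∧ Fintype.card V - k ≤ I.ncard) :
    ∀ M : Set (Sym2 V), IsMatchingSet G M → M.ncard ≤ k := by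
  obtain ⟨I, hirr, hcard⟩ := hI
  intro M hM
  have hle := hM.ncard_le_ncard_compl hirr
  have hsum := Set.ncard_add_ncard_compl I
  rw [Nat.card_eq_fintype_card] at hsum
  lia
end

section
/- Let G be a finite simple graph and v ∈ V(G) a vertex of degree exactly one. Then there exists a maximum-cardinality irredundant set I of G with v ∈ I. -/
/-- If `x` is the only neighbor of `v`, then `v` may replace `w` in an irredundant set `I`,
provided that `x ∉ I \ {w}` and `x` is a private neighbor of no vertex of `I` other than `w`. -/
theorem Irredundant.insert_diff_singleton {V : Type*} {G : SimpleGraph V} {I : Set V}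
    (hI : Irredundant G I) {v w x : V} (hN : ∀ u, G.Adj v u ↔ u = x) (hx : x ∈ I → x = w)
    (hw : ∀ a ∈ I, x ∉ I → G.Adj x a → (∀ b ∈ I, G.Adj x b → b = a) → a = w) :
    Irredundant G (insert v (I \ {w})) := by
  have hN' (u : V) : G.Adj u v ↔ u = x := by rw [G.adj_comm, hN]
  rintro a (rfl | ⟨ha, haw⟩)
  · left
    rintro u (rfl | ⟨hu, huw⟩) h
    · exact G.irrefl h
    · obtain rfl := (hN u).1 h
      exact huw (hx hu)
  have hax : a ≠ x := by
    rintro rfl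
    exact haw (hx ha)
  rcases hI a ha with h | ⟨u, hu, hua, huI⟩
  · left
    rintro u (rfl | ⟨hu, -⟩) hau
    · exact hax ((hN' a).1 hau)
    · exact h u hu hau
  · right
    have hux : u ≠ x := by
      rintro rfl
      exact haw (hw a ha hu hua huI)
    refine ⟨u, ?_, hua, ?_⟩
    · rintro (rfl | ⟨h, -⟩)
      · exact hax ((hN a).1 hua)
      · exact hu h
    · rintro b (rfl | ⟨hb, -⟩) hub
      · exact absurd ((hN' u).1 hub) hux
      · exact huI b hb hub

/-- if `v` has degree exactly one, then `G` has a maximum-cardinality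
irredundant set containing `v`. -/
theorem degree_one_in_max_irredundant {V : Type*} [Fintype V]
    (G : SimpleGraph V) (v : V) (hv : (G.neighborSet v).ncard = 1) :
    ∃ I : Set V, Irredundant G I ∧
      (∀ J : Set V, Irredundant G J → J.ncard ≤ I.ncard) ∧ v ∈ I := by
  obtain ⟨x, hx⟩ := Set.ncard_eq_one.1 hv
  have hN (u : V) : G.Adj v u ↔ u = x := by
    rw [← SimpleGraph.mem_neighborSet, hx, Set.mem_singleton_iff]
  obtain ⟨I, hI, hmax⟩ := Set.exists_max_image {I : Set V | Irredundant G I} Set.ncard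
    (Set.toFinite _) ⟨∅, fun _ h => h.elim⟩
  by_cases hvI : v ∈ I
  · exact ⟨I, hI, hmax, hvI⟩
  obtain ⟨w, hxw, hw⟩ : ∃ w, (x ∈ I → x = w) ∧
      ∀ a ∈ I, x ∉ I → G.Adj x a → (∀ b ∈ I, G.Adj x b → b = a) → a = w := by
    by_cases hxI : x ∈ I
    · exact ⟨x, fun _ => rfl, fun _ _ h => absurd hxI h⟩
    by_cases h : ∃ w ∈ I, G.Adj x w
    · obtain ⟨w, hw, hxw⟩ := h
      exact ⟨w, fun h => absurd h hxI, fun a _ _ _ h => (h w hw hxw).symm⟩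
    · exact ⟨v, fun h => absurd h hxI, fun a ha _ hxa _ => absurd ⟨a, ha, hxa⟩ h⟩
  refine ⟨insert v (I \ {w}), hI.insert_diff_singleton hN hxw hw, fun J hJ => ?_,
    Set.mem_insert _ _⟩
  have hcard := Set.pred_ncard_le_ncard_sdiff_singleton I w
  rw [Set.ncard_insert_of_notMem (fun h => hvI h.1) (Set.toFinite _)]
  have := hmax J hJ
  lia
end
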